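/- For every split distribution p' ≃ p, the rate-splitting region is contained in the simultaneous-decoding region: for any (R₁,R₂) with R₁ ≤ I(X₁;Y₁) + I(X;Y₁|X₁,W) and R₂ ≤ I(W;Y₁|X₁), one has R₁ ≤ I(X;Y₁|W), R₂ ≤ I(W;Y₁|X), and R₁ + R₂ ≤ I(X,W;Y₁); hence 𝓡_RS(p') ⊆ 𝓡₁,SD(p). -/

import Mathlib

open scoped BigOperators Classical

noncomputable section

/-- Pushforward of a finitely supported weight function along a map. -/
def pushf {Ω β : Type*} [Fintype Ω] (q : Ω → ℝ) (f : Ω → β) : β → ℝ :=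
  fun b => ∑ ω, if f ω = b then q ω else 0

/-- Shannon entropy (in nats). -/
def ent {β : Type*} [Fintype β] (p : β → ℝ) : ℝ :=
  -∑ b, p b * Real.log (p b)

/-- Entropy of the random variable `A` under the joint pmf `q`. -/
def Hof {Ω β : Type*} [Fintype Ω] [Fintype β] (q : Ω → ℝ) (A : Ω → β) : ℝ :=
  ent (pushf q A)

/-- Mutual information `I(A;B)` under the joint pmf `q`. -/
def miOf {Ω α β : Type*} [Fintype Ω] [Fintype α] [Fintype β]
    (q : Ω → ℝ) (A : Ω → α) (B : Ω → β) : ℝ :=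
  Hof q A + Hof q B - Hof q (fun ω => (A ω, B ω))

/-- Conditional mutual information `I(A;B|C)` under the joint pmf `q`. -/
def cmiOf {Ω α β γ : Type*} [Fintype Ω] [Fintype α] [Fintype β] [Fintype γ]
    (q : Ω → ℝ) (A : Ω → α) (B : Ω → β) (C : Ω → γ) : ℝ :=
  Hof q (fun ω => (A ω, C ω)) + Hof q (fun ω => (B ω, C ω))
    - Hof q (fun ω => (A ω, B ω, C ω)) - Hof q C

/-- `p` is a probability mass function. -/
def IsPMF {α : Type*} [Fintype α] (p : α → ℝ) : Prop :=
  (∀ a, 0 ≤ p a) ∧ ∑ a, p a = 1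

/-- Joint pmf on `(X, W, Y₁, Y₂)` induced by the product input pmf `pX · pW`
and the interference channel `ch`. -/
def icJoint {𝒳 𝒲 𝒴₁ 𝒴₂ : Type} (pX : 𝒳 → ℝ) (pW : 𝒲 → ℝ)
    (ch : 𝒳 → 𝒲 → 𝒴₁ → 𝒴₂ → ℝ) : 𝒳 × 𝒲 × 𝒴₁ × 𝒴₂ → ℝ :=
  fun ω => pX ω.1 * pW ω.2.1 * ch ω.1 ω.2.1 ω.2.2.1 ω.2.2.2

/-- The simultaneous-decoding region `𝓡₁,SD(p)` at receiver 1: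
`R₁ ≤ I(X;Y₁|W)`, `R₂ ≤ I(W;Y₁|X)`, `R₁+R₂ ≤ I(X,W;Y₁)`. -/
def R1SD {𝒳 𝒲 𝒴₁ 𝒴₂ : Type} [Fintype 𝒳] [Fintype 𝒲] [Fintype 𝒴₁] [Fintype 𝒴₂]
    (pX : 𝒳 → ℝ) (pW : 𝒲 → ℝ) (ch : 𝒳 → 𝒲 → 𝒴₁ → 𝒴₂ → ℝ) : Set (ℝ × ℝ) :=
  {R | 0 ≤ R.1 ∧ 0 ≤ R.2 ∧
    R.1 ≤ cmiOf (icJoint pX pW ch) (fun ω => ω.1) (fun ω => ω.2.2.1) (fun ω => ω.2.1) ∧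
    R.2 ≤ cmiOf (icJoint pX pW ch) (fun ω => ω.2.1) (fun ω => ω.2.2.1) (fun ω => ω.1) ∧
    R.1 + R.2 ≤ miOf (icJoint pX pW ch) (fun ω => (ω.1, ω.2.1)) (fun ω => ω.2.2.1)}

/-- A two-layer split distribution `p'` for sender 1, together with sender 2's pmf:
independent `X₁ ~ p1`, `X₂ ~ p2`, `W ~ pw` and a symbol-by-symbol map `f`. -/
structure SplitDist2 (𝒳 𝒲 : Type) [Fintype 𝒳] [Fintype 𝒲] where
  A1 : Type
  A2 : Type
  [fin1 : Fintype A1]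
  [fin2 : Fintype A2]
  p1 : A1 → ℝ
  p2 : A2 → ℝ
  pw : 𝒲 → ℝ
  f : A1 → A2 → 𝒳
  p1_pmf : IsPMF p1
  p2_pmf : IsPMF p2
  pw_pmf : IsPMF pw

attribute [instance] SplitDist2.fin1 SplitDist2.fin2

/-- `p' ≃ p` : the split distribution induces `X = f(X₁,X₂) ~ pX` and `W ~ pW`. -/
def SplitDist2.Matches {𝒳 𝒲 : Type} [Fintype 𝒳] [Fintype 𝒲]
    (s : SplitDist2 𝒳 𝒲) (pX : 𝒳 → ℝ) (pW : 𝒲 → ℝ) : Prop :=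
  (∀ x, pushf (fun a : s.A1 × s.A2 => s.p1 a.1 * s.p2 a.2) (fun a => s.f a.1 a.2) x = pX x)
    ∧ s.pw = pW

/-- Joint pmf on `(X₁, X₂, W, Y₁, Y₂)` induced by a split distribution and the channel. -/
def rsJoint {𝒳 𝒲 𝒴₁ 𝒴₂ : Type} [Fintype 𝒳] [Fintype 𝒲] (s : SplitDist2 𝒳 𝒲)
    (ch : 𝒳 → 𝒲 → 𝒴₁ → 𝒴₂ → ℝ) : s.A1 × s.A2 × 𝒲 × 𝒴₁ × 𝒴₂ → ℝ :=
  fun ω => s.p1 ω.1 * s.p2 ω.2.1 * s.pw ω.2.2.1 *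
    ch (s.f ω.1 ω.2.1) ω.2.2.1 ω.2.2.2.1 ω.2.2.2.2

/-- The rate-splitting region `𝓡_RS(p')`:
`R₁ ≤ I(X₁;Y₁) + I(X;Y₁|X₁,W)` and `R₂ ≤ I(W;Y₁|X₁)`. -/
def RRS {𝒳 𝒲 𝒴₁ 𝒴₂ : Type} [Fintype 𝒳] [Fintype 𝒲] [Fintype 𝒴₁] [Fintype 𝒴₂]
    (s : SplitDist2 𝒳 𝒲) (ch : 𝒳 → 𝒲 → 𝒴₁ → 𝒴₂ → ℝ) : Set (ℝ × ℝ) :=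
  {R | 0 ≤ R.1 ∧ 0 ≤ R.2 ∧
    R.1 ≤ miOf (rsJoint s ch) (fun ω => ω.1) (fun ω => ω.2.2.2.1)
          + cmiOf (rsJoint s ch) (fun ω => s.f ω.1 ω.2.1) (fun ω => ω.2.2.2.1)
              (fun ω => (ω.1, ω.2.2.1)) ∧
    R.2 ≤ cmiOf (rsJoint s ch) (fun ω => ω.2.2.1) (fun ω => ω.2.2.2.1) (fun ω => ω.1)}

/-- The expectation of a function of `A` may be computed from the law of `A`. -/
theorem sum_pushf_mul {Ω β : Type*} [Fintype Ω] [Fintype β] (q : Ω → ℝ) (A : Ω → β) (F : β → ℝ) :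
    ∑ b, pushf q A b * F b = ∑ ω, q ω * F (A ω) := by
  simp only [pushf, Finset.sum_mul]
  rw [Finset.sum_comm]
  simp [ite_mul]

theorem pushf_nonneg {Ω β : Type*} [Fintype Ω] {q : Ω → ℝ} (hq : ∀ ω, 0 ≤ q ω) (A : Ω → β)
    (b : β) : 0 ≤ pushf q A b :=
  Finset.sum_nonneg fun ω _ => by split_ifs <;> simp [hq]

theorem pushf_apply_pos {Ω β : Type*} [Fintype Ω] {q : Ω → ℝ} (hq : ∀ ω, 0 ≤ q ω) (A : Ω → β)
    {ω : Ω} (hω : q ω ≠ 0) : 0 < pushf q A (A ω) := by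
  refine Finset.sum_pos' (fun η _ => by split_ifs <;> simp [hq]) ⟨ω, Finset.mem_univ _, ?_⟩
  simpa using lt_of_le_of_ne (hq ω) hω.symm

theorem pushf_pushf {Ω β γ : Type*} [Fintype Ω] [Fintype β] (q : Ω → ℝ) (g : Ω → β) (A : β → γ) :
    pushf (pushf q g) A = pushf q fun ω => A (g ω) := by
  funext c
  simpa [pushf] using sum_pushf_mul q g fun b => if A b = c then 1 else 0

theorem Hof_pushf {Ω β γ : Type*} [Fintype Ω] [Fintype β] [Fintype γ] (q : Ω → ℝ) (g : Ω → β)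
    (A : β → γ) : Hof (pushf q g) A = Hof q fun ω => A (g ω) := by
  simp only [Hof, pushf_pushf]

/-- Entropy as the expected negative log-likelihood. -/
theorem Hof_eq_neg_sum {Ω β : Type*} [Fintype Ω] [Fintype β] (q : Ω → ℝ) (A : Ω → β) :
    Hof q A = -∑ ω, q ω * Real.log (pushf q A (A ω)) := by
  simp only [Hof, ent, sum_pushf_mul q A fun b => Real.log (pushf q A b)]

theorem Hof_comp_injective {Ω β γ : Type*} [Fintype Ω] [Fintype β] [Fintype γ] (q : Ω → ℝ)
    (A : Ω → β) {e : β → γ} (he : Function.Injective e) :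
    Hof q (fun ω => e (A ω)) = Hof q A := by
  simp only [Hof_eq_neg_sum, pushf, he.eq_iff]

theorem Hof_swap {Ω α β : Type*} [Fintype Ω] [Fintype α] [Fintype β] (q : Ω → ℝ)
    (A : Ω → α) (B : Ω → β) :
    Hof q (fun ω => (B ω, A ω)) = Hof q (fun ω => (A ω, B ω)) :=
  Hof_comp_injective q (fun ω => (A ω, B ω)) Prod.swap_injective

theorem Hof_rotate {Ω α β γ : Type*} [Fintype Ω] [Fintype α] [Fintype β] [Fintype γ] (q : Ω → ℝ)
    (A : Ω → α) (B : Ω → β) (C : Ω → γ) :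
    Hof q (fun ω => (B ω, C ω, A ω)) = Hof q (fun ω => (A ω, B ω, C ω)) :=
  Hof_comp_injective q (fun ω => (A ω, B ω, C ω)) (e := fun v => (v.2.1, v.2.2, v.1))
    (by rintro ⟨_, _, _⟩ ⟨_, _, _⟩; simp +contextual)

theorem sum_pushf_prodMk_left {Ω α γ : Type*} [Fintype Ω] [Fintype α] (q : Ω → ℝ) (A : Ω → α)
    (C : Ω → γ) (c : γ) : ∑ a, pushf q (fun ω => (A ω, C ω)) (a, c) = pushf q C c := by
  simp only [pushf, Prod.mk.injEq, ite_and]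
  rw [Finset.sum_comm]
  simp

theorem sum_pushf {Ω β : Type*} [Fintype Ω] [Fintype β] (q : Ω → ℝ) (A : Ω → β) :
    ∑ b, pushf q A b = ∑ ω, q ω := by
  simpa using sum_pushf_mul q A fun _ => 1

/-- Submodularity of entropy. -/
theorem cmiOf_nonneg {Ω α β γ : Type*} [Fintype Ω] [Fintype α] [Fintype β] [Fintype γ]
    {q : Ω → ℝ} (hq : ∀ ω, 0 ≤ q ω) (A : Ω → α) (B : Ω → β) (C : Ω → γ) :
    0 ≤ cmiOf q A B C := by
  set pAC := pushf q fun ω => (A ω, C ω)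
  set pBC := pushf q fun ω => (B ω, C ω)
  set pABC := pushf q fun ω => (A ω, B ω, C ω)
  set pC := pushf q C
  have hAC : ∀ v, 0 ≤ pAC v := pushf_nonneg hq _
  have hBC : ∀ v, 0 ≤ pBC v := pushf_nonneg hq _
  have hABC : ∀ v, 0 ≤ pABC v := pushf_nonneg hq _
  have hC : ∀ v, 0 ≤ pC v := pushf_nonneg hq _
  let r : α × β × γ → ℝ := fun v => pAC (v.1, v.2.2) * pBC v.2 / pC v.2.2
  have hr : ∑ v, r v = ∑ ω, q ω := by
    have hc : ∀ c, ∑ a, ∑ b, r (a, b, c) = pC c := fun c => by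
      have : ∑ a, ∑ b, r (a, b, c) = (∑ a, pAC (a, c)) * (∑ b, pBC (b, c)) / pC c := by
        simp only [r, Finset.sum_mul_sum, Finset.sum_div]
      rw [this, sum_pushf_prodMk_left, sum_pushf_prodMk_left]
      exact mul_self_div_self _
    rw [← sum_pushf q C]
    simp only [Fintype.sum_prod_type]
    rw [← Finset.sum_congr rfl fun c _ => hc c, Finset.sum_comm_cycle]
  have hle : ∑ ω, q ω * (r (A ω, B ω, C ω) / pABC (A ω, B ω, C ω)) ≤ ∑ ω, q ω := by
    rw [← hr, ← sum_pushf_mul q (fun ω => (A ω, B ω, C ω)) fun v => r v / pABC v]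
    refine Finset.sum_le_sum fun v _ => ?_
    have : 0 ≤ r v := div_nonneg (mul_nonneg (hAC _) (hBC _)) (hC _)
    by_cases h : pABC v = 0
    · simpa [pABC, h] using this
    · exact (mul_div_cancel₀ _ h).le
  have key : ∑ ω, q ω * (1 - r (A ω, B ω, C ω) / pABC (A ω, B ω, C ω)) ≤ cmiOf q A B C := by
    simp only [cmiOf, Hof_eq_neg_sum, ← sub_eq_add_neg, ← Finset.sum_neg_distrib,
      ← Finset.sum_sub_distrib, ← Finset.sum_add_distrib]
    refine Finset.sum_le_sum fun ω _ => ?_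
    by_cases h : q ω = 0
    · simp [h]
    have h1 : 0 < pAC (A ω, C ω) := pushf_apply_pos hq (fun ω => (A ω, C ω)) h
    have h2 : 0 < pBC (B ω, C ω) := pushf_apply_pos hq (fun ω => (B ω, C ω)) h
    have h3 : 0 < pABC (A ω, B ω, C ω) := pushf_apply_pos hq (fun ω => (A ω, B ω, C ω)) h
    have h4 : 0 < pC (C ω) := pushf_apply_pos hq C h
    have h5 := Real.log_le_sub_one_of_pos (div_pos (div_pos (mul_pos h1 h2) h4) h3)
    rw [Real.log_div (by positivity) h3.ne', Real.log_div (by positivity) h4.ne',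
      Real.log_mul h1.ne' h2.ne'] at h5
    have h6 := mul_le_mul_of_nonneg_left h5 (hq ω)
    simp only [r, pAC, pBC, pABC, pC] at h6 ⊢
    linarith
  simp only [mul_sub, mul_one, Finset.sum_sub_distrib] at key
  linarith

/-- If `p(a) p(b) = p(c) p(d)` on the support, the corresponding entropies add up. -/
theorem Hof_add_Hof_eq {Ω α β γ δ : Type*} [Fintype Ω] [Fintype α] [Fintype β] [Fintype γ]
    [Fintype δ] {q : Ω → ℝ} (hq : ∀ ω, 0 ≤ q ω) (A : Ω → α) (B : Ω → β) (C : Ω → γ) (D : Ω → δ)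
    (h : ∀ ω, pushf q A (A ω) * pushf q B (B ω) = pushf q C (C ω) * pushf q D (D ω)) :
    Hof q A + Hof q B = Hof q C + Hof q D := by
  simp only [Hof_eq_neg_sum, ← Finset.sum_neg_distrib, ← Finset.sum_add_distrib]
  refine Finset.sum_congr rfl fun ω _ => ?_
  by_cases hω : q ω = 0
  · simp [hω]
  have hlog := congrArg Real.log (h ω)
  rw [Real.log_mul (pushf_apply_pos hq A hω).ne' (pushf_apply_pos hq B hω).ne',
    Real.log_mul (pushf_apply_pos hq C hω).ne' (pushf_apply_pos hq D hω).ne'] at hlog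
  linear_combination -q ω * hlog

/-- If `p(a) = p(b) p(c)` on the support, then `H(A) = H(B) + H(C)`. -/
theorem Hof_eq_add {Ω α β γ : Type*} [Fintype Ω] [Fintype α] [Fintype β] [Fintype γ]
    {q : Ω → ℝ} (hq : ∀ ω, 0 ≤ q ω) (A : Ω → α) (B : Ω → β) (C : Ω → γ)
    (h : ∀ ω, pushf q A (A ω) = pushf q B (B ω) * pushf q C (C ω)) :
    Hof q A = Hof q B + Hof q C := by
  simp only [Hof_eq_neg_sum, ← Finset.sum_neg_distrib, ← Finset.sum_add_distrib]
  refine Finset.sum_congr rfl fun ω _ => ?_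
  by_cases hω : q ω = 0
  · simp [hω]
  rw [h ω, Real.log_mul (pushf_apply_pos hq B hω).ne' (pushf_apply_pos hq C hω).ne']
  ring

/-- The single-letter inequalities behind rate splitting: `W` is independent of `(U, X)` and
`U → X → (W, Y)` is a Markov chain, both expressed through entropies. -/
theorem split_inequalities {Ω α β γ δ : Type*} [Fintype Ω] [Fintype α] [Fintype β] [Fintype γ]
    [Fintype δ] {q : Ω → ℝ} (hq : ∀ ω, 0 ≤ q ω) (U : Ω → α) (X : Ω → β) (W : Ω → γ) (Y : Ω → δ)
    (hUW : Hof q (fun ω => (U ω, W ω)) = Hof q U + Hof q W)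
    (hXW : Hof q (fun ω => (X ω, W ω)) = Hof q X + Hof q W)
    (hUXW : Hof q (fun ω => ((U ω, X ω), W ω)) = Hof q (fun ω => (U ω, X ω)) + Hof q W)
    (hM : Hof q (fun ω => ((U ω, X ω), W ω, Y ω)) + Hof q X =
      Hof q (fun ω => (U ω, X ω)) + Hof q (fun ω => (X ω, W ω, Y ω))) :
    miOf q U Y + cmiOf q X Y (fun ω => (U ω, W ω)) ≤ cmiOf q X Y W ∧
    cmiOf q W Y U ≤ cmiOf q W Y X ∧
    miOf q U Y + cmiOf q X Y (fun ω => (U ω, W ω)) + cmiOf q W Y U =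
      miOf q (fun ω => (X ω, W ω)) Y := by
  have h1 := cmiOf_nonneg hq U W Y
  have h2 := cmiOf_nonneg hq W X fun ω => (Y ω, U ω)
  have h3 := cmiOf_nonneg hq Y U X
  have e1 : Hof q (fun ω => (X ω, U ω, W ω)) = Hof q (fun ω => ((U ω, X ω), W ω)) :=
    Hof_comp_injective q (fun ω => ((U ω, X ω), W ω)) (e := fun v => (v.1.2, v.1.1, v.2))
      (by rintro ⟨⟨_, _⟩, _⟩ ⟨⟨_, _⟩, _⟩; simp +contextual)
  have e2 : Hof q (fun ω => (X ω, Y ω, U ω, W ω)) = Hof q (fun ω => ((U ω, X ω), W ω, Y ω)) :=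
    Hof_comp_injective q (fun ω => ((U ω, X ω), W ω, Y ω))
      (e := fun v => (v.1.2, v.2.2, v.1.1, v.2.1))
      (by rintro ⟨⟨_, _⟩, _, _⟩ ⟨⟨_, _⟩, _, _⟩; simp +contextual)
  have e3 : Hof q (fun ω => (W ω, X ω, Y ω, U ω)) = Hof q (fun ω => ((U ω, X ω), W ω, Y ω)) :=
    Hof_comp_injective q (fun ω => ((U ω, X ω), W ω, Y ω))
      (e := fun v => (v.2.1, v.1.2, v.2.2, v.1.1))
      (by rintro ⟨⟨_, _⟩, _, _⟩ ⟨⟨_, _⟩, _, _⟩; simp +contextual)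
  have e4 : Hof q (fun ω => (X ω, Y ω, W ω)) = Hof q (fun ω => (X ω, W ω, Y ω)) :=
    Hof_comp_injective q (fun ω => (X ω, W ω, Y ω)) (e := fun v => (v.1, v.2.2, v.2.1))
      (by rintro ⟨_, _, _⟩ ⟨_, _, _⟩; simp +contextual)
  have e5 : Hof q (fun ω => ((X ω, W ω), Y ω)) = Hof q (fun ω => (X ω, W ω, Y ω)) :=
    Hof_comp_injective q (fun ω => (X ω, W ω, Y ω)) (Equiv.prodAssoc β γ δ).symm.injective
  have r1 := Hof_rotate q U W Y
  have r2 := Hof_rotate q W Y U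
  have r3 := Hof_rotate q X W Y
  have r4 := Hof_rotate q X Y U
  have s1 := Hof_swap q W Y
  have s2 := Hof_swap q U Y
  have s3 := Hof_swap q U W
  have s4 := Hof_swap q X W
  simp only [miOf, cmiOf] at *
  refine ⟨?_, ?_, ?_⟩ <;> linarith

/-- The law of `(h(X₁,X₂), W, Y₁, Y₂)` when `X` is a function `c` of `h(X₁,X₂)`. -/
theorem pushf_rsJoint {𝒳 𝒲 𝒴₁ 𝒴₂ β : Type} [Fintype 𝒳] [Fintype 𝒲] [Fintype 𝒴₁] [Fintype 𝒴₂]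
    (s : SplitDist2 𝒳 𝒲) (ch : 𝒳 → 𝒲 → 𝒴₁ → 𝒴₂ → ℝ) (h : s.A1 → s.A2 → β) (c : β → 𝒳)
    (hc : ∀ a₁ a₂, c (h a₁ a₂) = s.f a₁ a₂) (v : β × 𝒲 × 𝒴₁ × 𝒴₂) :
    pushf (rsJoint s ch) (fun ω => (h ω.1 ω.2.1, ω.2.2)) v =
      pushf (fun a : s.A1 × s.A2 => s.p1 a.1 * s.p2 a.2) (fun a => h a.1 a.2) v.1 *
        s.pw v.2.1 * ch (c v.1) v.2.1 v.2.2.1 v.2.2.2 := by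
  obtain ⟨b, w, y₁, y₂⟩ := v
  simp only [pushf, rsJoint, Fintype.sum_prod_type, Prod.mk.injEq, ite_and, Finset.sum_mul,
    ite_mul, zero_mul]
  refine Finset.sum_congr rfl fun a₁ _ => Finset.sum_congr rfl fun a₂ _ => ?_
  split_ifs with hb
  · subst hb
    simp [hc]
  · simp

theorem rsJoint_nonneg {𝒳 𝒲 𝒴₁ 𝒴₂ : Type} [Fintype 𝒳] [Fintype 𝒲] {s : SplitDist2 𝒳 𝒲}
    {ch : 𝒳 → 𝒲 → 𝒴₁ → 𝒴₂ → ℝ} (hch0 : ∀ x w y₁ y₂, 0 ≤ ch x w y₁ y₂) (ω) :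
    0 ≤ rsJoint s ch ω :=
  mul_nonneg (mul_nonneg (mul_nonneg (s.p1_pmf.1 _) (s.p2_pmf.1 _)) (s.pw_pmf.1 _))
    (hch0 _ _ _ _)

/-- The law of `(h(X₁,X₂), W, Y₁)` when `X` is a function `c` of `h(X₁,X₂)`. -/
theorem pushf_rsJoint_output {𝒳 𝒲 𝒴₁ 𝒴₂ β : Type} [Fintype 𝒳] [Fintype 𝒲] [Fintype 𝒴₁]
    [Fintype 𝒴₂] (s : SplitDist2 𝒳 𝒲) (ch : 𝒳 → 𝒲 → 𝒴₁ → 𝒴₂ → ℝ) (h : s.A1 → s.A2 → β)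
    (c : β → 𝒳) (hc : ∀ a₁ a₂, c (h a₁ a₂) = s.f a₁ a₂) (v : β × 𝒲 × 𝒴₁) :
    pushf (rsJoint s ch) (fun ω => (h ω.1 ω.2.1, ω.2.2.1, ω.2.2.2.1)) v =
      pushf (fun a : s.A1 × s.A2 => s.p1 a.1 * s.p2 a.2) (fun a => h a.1 a.2) v.1 *
        s.pw v.2.1 * ∑ y₂, ch (c v.1) v.2.1 v.2.2 y₂ := by
  obtain ⟨b, w, y₁⟩ := v
  simp only [pushf, rsJoint, Fintype.sum_prod_type, Prod.mk.injEq, ite_and, Finset.sum_mul,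
    ite_mul, zero_mul]
  refine Finset.sum_congr rfl fun a₁ _ => Finset.sum_congr rfl fun a₂ _ => ?_
  split_ifs with hb
  · subst hb
    simp [hc, Finset.mul_sum, Finset.sum_ite_irrel]
  · simp

/-- `W` is independent of `(X₁, X₂)`. -/
theorem pushf_rsJoint_input {𝒳 𝒲 𝒴₁ 𝒴₂ β : Type} [Fintype 𝒳] [Fintype 𝒲] [Fintype 𝒴₁]
    [Fintype 𝒴₂] (s : SplitDist2 𝒳 𝒲) {ch : 𝒳 → 𝒲 → 𝒴₁ → 𝒴₂ → ℝ}
    (hch1 : ∀ x w, ∑ y₁, ∑ y₂, ch x w y₁ y₂ = 1) (h : s.A1 → s.A2 → β) (v : β × 𝒲) :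
    pushf (rsJoint s ch) (fun ω => (h ω.1 ω.2.1, ω.2.2.1)) v =
      pushf (fun a : s.A1 × s.A2 => s.p1 a.1 * s.p2 a.2) (fun a => h a.1 a.2) v.1 * s.pw v.2 := by
  obtain ⟨b, w⟩ := v
  simp only [pushf, rsJoint, Fintype.sum_prod_type, Prod.mk.injEq, ite_and, Finset.sum_mul,
    ite_mul, zero_mul]
  refine Finset.sum_congr rfl fun a₁ _ => Finset.sum_congr rfl fun a₂ _ => ?_
  split_ifs with hb
  · simp [← Finset.mul_sum, Finset.sum_ite_irrel, hch1]
  · simp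

theorem pushf_rsJoint_sender_one {𝒳 𝒲 𝒴₁ 𝒴₂ β : Type} [Fintype 𝒳] [Fintype 𝒲] [Fintype 𝒴₁]
    [Fintype 𝒴₂] (s : SplitDist2 𝒳 𝒲) {ch : 𝒳 → 𝒲 → 𝒴₁ → 𝒴₂ → ℝ}
    (hch1 : ∀ x w, ∑ y₁, ∑ y₂, ch x w y₁ y₂ = 1) (h : s.A1 → s.A2 → β) (b : β) :
    pushf (rsJoint s ch) (fun ω => h ω.1 ω.2.1) b =
      pushf (fun a : s.A1 × s.A2 => s.p1 a.1 * s.p2 a.2) (fun a => h a.1 a.2) b := by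
  simp only [pushf, rsJoint, Fintype.sum_prod_type]
  refine Finset.sum_congr rfl fun a₁ _ => Finset.sum_congr rfl fun a₂ _ => ?_
  split_ifs with hb
  · simp [← Finset.mul_sum, hch1, s.pw_pmf.2]
  · simp

theorem pushf_rsJoint_sender_two {𝒳 𝒲 𝒴₁ 𝒴₂ : Type} [Fintype 𝒳] [Fintype 𝒲] [Fintype 𝒴₁]
    [Fintype 𝒴₂] (s : SplitDist2 𝒳 𝒲) {ch : 𝒳 → 𝒲 → 𝒴₁ → 𝒴₂ → ℝ}
    (hch1 : ∀ x w, ∑ y₁, ∑ y₂, ch x w y₁ y₂ = 1) (w : 𝒲) :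
    pushf (rsJoint s ch) (fun ω => ω.2.2.1) w = s.pw w := by
  simp [pushf, rsJoint, Fintype.sum_prod_type, Finset.sum_ite_irrel, ← Finset.mul_sum, hch1,
    ← Finset.sum_mul, s.p1_pmf.2, s.p2_pmf.2]

/-- `W` is independent of every function of `(X₁, X₂)`, in terms of entropies. -/
theorem Hof_rsJoint_input {𝒳 𝒲 𝒴₁ 𝒴₂ β : Type} [Fintype 𝒳] [Fintype 𝒲] [Fintype 𝒴₁]
    [Fintype 𝒴₂] [Fintype β] (s : SplitDist2 𝒳 𝒲) {ch : 𝒳 → 𝒲 → 𝒴₁ → 𝒴₂ → ℝ}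
    (hch0 : ∀ x w y₁ y₂, 0 ≤ ch x w y₁ y₂)
    (hch1 : ∀ x w, ∑ y₁, ∑ y₂, ch x w y₁ y₂ = 1) (h : s.A1 → s.A2 → β) :
    Hof (rsJoint s ch) (fun ω => (h ω.1 ω.2.1, ω.2.2.1)) =
      Hof (rsJoint s ch) (fun ω => h ω.1 ω.2.1) + Hof (rsJoint s ch) (fun ω => ω.2.2.1) :=
  Hof_eq_add (rsJoint_nonneg hch0) _ _ _ fun ω => by
    rw [pushf_rsJoint_input s hch1, pushf_rsJoint_sender_one s hch1,
      pushf_rsJoint_sender_two s hch1]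

/-- `X₁ → X → (W, Y₁)` is a Markov chain, in terms of entropies. -/
theorem Hof_rsJoint_markov {𝒳 𝒲 𝒴₁ 𝒴₂ : Type} [Fintype 𝒳] [Fintype 𝒲] [Fintype 𝒴₁]
    [Fintype 𝒴₂] (s : SplitDist2 𝒳 𝒲) {ch : 𝒳 → 𝒲 → 𝒴₁ → 𝒴₂ → ℝ}
    (hch0 : ∀ x w y₁ y₂, 0 ≤ ch x w y₁ y₂)
    (hch1 : ∀ x w, ∑ y₁, ∑ y₂, ch x w y₁ y₂ = 1) :
    Hof (rsJoint s ch) (fun ω => ((ω.1, s.f ω.1 ω.2.1), ω.2.2.1, ω.2.2.2.1)) +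
        Hof (rsJoint s ch) (fun ω => s.f ω.1 ω.2.1) =
      Hof (rsJoint s ch) (fun ω => (ω.1, s.f ω.1 ω.2.1)) +
        Hof (rsJoint s ch) (fun ω => (s.f ω.1 ω.2.1, ω.2.2.1, ω.2.2.2.1)) :=
  Hof_add_Hof_eq (rsJoint_nonneg hch0) _ _ _ _ fun ω => by
    rw [pushf_rsJoint_output s ch (fun a₁ a₂ => (a₁, s.f a₁ a₂)) Prod.snd fun _ _ => rfl,
      pushf_rsJoint_output s ch s.f id fun _ _ => rfl, pushf_rsJoint_sender_one s hch1 s.f,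
      pushf_rsJoint_sender_one s hch1 fun a₁ a₂ => (a₁, s.f a₁ a₂)]
    simp only [id]
    ring

theorem icJoint_eq_pushf_rsJoint {𝒳 𝒲 𝒴₁ 𝒴₂ : Type} [Fintype 𝒳] [Fintype 𝒲] [Fintype 𝒴₁]
    [Fintype 𝒴₂] {pX : 𝒳 → ℝ} {pW : 𝒲 → ℝ} (ch : 𝒳 → 𝒲 → 𝒴₁ → 𝒴₂ → ℝ) {s : SplitDist2 𝒳 𝒲}
    (hmatch : s.Matches pX pW) :
    icJoint pX pW ch = pushf (rsJoint s ch) (fun ω => (s.f ω.1 ω.2.1, ω.2.2)) := by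
  funext v
  rw [pushf_rsJoint s ch s.f id fun _ _ => rfl, hmatch.1, hmatch.2]
  rfl

/-- For every split distribution `p' ≃ p`, the rate-splitting bounds imply the
simultaneous-decoding bounds; hence `𝓡_RS(p') ⊆ 𝓡₁,SD(p)`. -/
theorem rs_subset_sd {𝒳 𝒲 𝒴₁ 𝒴₂ : Type}
    [Fintype 𝒳] [Fintype 𝒲] [Fintype 𝒴₁] [Fintype 𝒴₂]
    (pX : 𝒳 → ℝ) (pW : 𝒲 → ℝ) (ch : 𝒳 → 𝒲 → 𝒴₁ → 𝒴₂ → ℝ)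
    (hpX : IsPMF pX) (hpW : IsPMF pW)
    (hch0 : ∀ x w y₁ y₂, 0 ≤ ch x w y₁ y₂)
    (hch1 : ∀ x w, ∑ y₁, ∑ y₂, ch x w y₁ y₂ = 1)
    (s : SplitDist2 𝒳 𝒲) (hmatch : s.Matches pX pW) :
    (∀ R₁ R₂ : ℝ,
      R₁ ≤ miOf (rsJoint s ch) (fun ω => ω.1) (fun ω => ω.2.2.2.1)
            + cmiOf (rsJoint s ch) (fun ω => s.f ω.1 ω.2.1) (fun ω => ω.2.2.2.1)
                (fun ω => (ω.1, ω.2.2.1)) →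
      R₂ ≤ cmiOf (rsJoint s ch) (fun ω => ω.2.2.1) (fun ω => ω.2.2.2.1) (fun ω => ω.1) →
        (R₁ ≤ cmiOf (icJoint pX pW ch) (fun ω => ω.1) (fun ω => ω.2.2.1) (fun ω => ω.2.1) ∧
         R₂ ≤ cmiOf (icJoint pX pW ch) (fun ω => ω.2.1) (fun ω => ω.2.2.1) (fun ω => ω.1) ∧
         R₁ + R₂ ≤ miOf (icJoint pX pW ch) (fun ω => (ω.1, ω.2.1)) (fun ω => ω.2.2.1))) ∧
    RRS s ch ⊆ R1SD pX pW ch := by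
  have key := split_inequalities (rsJoint_nonneg (s := s) hch0) (fun ω => ω.1)
    (fun ω => s.f ω.1 ω.2.1) (fun ω => ω.2.2.1) (fun ω => ω.2.2.2.1)
    (Hof_rsJoint_input s hch0 hch1 fun a₁ _ => a₁) (Hof_rsJoint_input s hch0 hch1 s.f)
    (Hof_rsJoint_input s hch0 hch1 fun a₁ a₂ => (a₁, s.f a₁ a₂))
    (Hof_rsJoint_markov s hch0 hch1)
  have main : ∀ R₁ R₂ : ℝ, _ → _ → _ := fun R₁ R₂
      (h₁ : R₁ ≤ miOf (rsJoint s ch) (fun ω => ω.1) (fun ω => ω.2.2.2.1)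
        + cmiOf (rsJoint s ch) (fun ω => s.f ω.1 ω.2.1) (fun ω => ω.2.2.2.1)
            (fun ω => (ω.1, ω.2.2.1)))
      (h₂ : R₂ ≤ cmiOf (rsJoint s ch) (fun ω => ω.2.2.1) (fun ω => ω.2.2.2.1) (fun ω => ω.1)) =>
    show R₁ ≤ cmiOf (icJoint pX pW ch) (fun ω => ω.1) (fun ω => ω.2.2.1) (fun ω => ω.2.1) ∧
        R₂ ≤ cmiOf (icJoint pX pW ch) (fun ω => ω.2.1) (fun ω => ω.2.2.1) (fun ω => ω.1) ∧
        R₁ + R₂ ≤ miOf (icJoint pX pW ch) (fun ω => (ω.1, ω.2.1)) (fun ω => ω.2.2.1) by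
      rw [icJoint_eq_pushf_rsJoint ch hmatch]
      simp only [cmiOf, miOf, Hof_pushf] at key h₁ h₂ ⊢
      exact ⟨h₁.trans key.1, h₂.trans key.2.1, (add_le_add h₁ h₂).trans key.2.2.le⟩
  exact ⟨main, fun R ⟨h0₁, h0₂, h₁, h₂⟩ => ⟨h0₁, h0₂, main R.1 R.2 h₁ h₂⟩⟩
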